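/- arXiv:2109.10218 — 3 statements merged into one kernel-verified Lean document; each statement's English description precedes it below -/
import Mathlib

section
/- Let p = ℘(·; g₂, g₃) be a Weierstrass elliptic function with fundamental half-periods ω, ω′, and let q = ℘(·; ω, ω′/2) be the function obtained by halving the period 2ω′. If b = p(ω′), then the invariants of q are h₂ = 60b² − 4g₂ and h₃ = 56b³ + 8g₃. -/
open Complex

/-- The Weierstrass ℘-function for the lattice generated by `2ω` and `2ω'`. -/
noncomputable def wp (ω ω' : ℂ) (z : ℂ) : ℂ :=
  1 / z ^ 2 + ∑' p : {p : ℤ × ℤ // p ≠ 0},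
    (1 / (z - (2 * (p.1.1 : ℂ) * ω + 2 * (p.1.2 : ℂ) * ω')) ^ 2
      - 1 / (2 * (p.1.1 : ℂ) * ω + 2 * (p.1.2 : ℂ) * ω') ^ 2)

/-- The quadrinvariant g₂ of the lattice generated by `2ω` and `2ω'`. -/
noncomputable def g2inv (ω ω' : ℂ) : ℂ :=
  60 * ∑' p : {p : ℤ × ℤ // p ≠ 0},
    1 / (2 * (p.1.1 : ℂ) * ω + 2 * (p.1.2 : ℂ) * ω') ^ 4

/-- The cubinvariant g₃ of the lattice generated by `2ω` and `2ω'`. -/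
noncomputable def g3inv (ω ω' : ℂ) : ℂ :=
  140 * ∑' p : {p : ℤ × ℤ // p ≠ 0},
    1 / (2 * (p.1.1 : ℂ) * ω + 2 * (p.1.2 : ℂ) * ω') ^ 6

open Filter Topology in
/-- The second order differential equation `℘'' = 6℘² - g₂/2`. -/
theorem PeriodPair.deriv_derivWeierstrassP (L : PeriodPair) {z : ℂ} (hz : z ∉ L.lattice) :
    deriv L.derivWeierstrassP z = 6 * L.weierstrassP z ^ 2 - L.g₂ / 2 := by
  have hopen : IsOpen (L.lattice : Set ℂ)ᶜ := L.isClosed_lattice.isOpen_compl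
  have hcount : (L.lattice : Set ℂ).Countable :=
    Set.countable_coe_iff.mp (L.latticeEquivProd.toEquiv.countable_iff.mpr inferInstance)
  have hconn : IsPreconnected (L.lattice : Set ℂ)ᶜ :=
    (hcount.isConnected_compl_of_one_lt_rank
      (by rw [Complex.rank_real_complex]; norm_num)).isPreconnected
  have hP := L.analyticOnNhd_weierstrassP
  have hP' := L.analyticOnNhd_derivWeierstrassP
  have hderiv {w : ℂ} (hw : w ∈ (L.lattice : Set ℂ)ᶜ) :
      HasDerivAt L.weierstrassP (L.derivWeierstrassP w) w := by
    simpa using (hP w hw).differentiableAt.hasDerivAt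
  have hderiv' {w : ℂ} (hw : w ∈ (L.lattice : Set ℂ)ᶜ) :
      HasDerivAt L.derivWeierstrassP (deriv L.derivWeierstrassP w) w :=
    (hP' w hw).differentiableAt.hasDerivAt
  have hmul : ∀ w ∈ (L.lattice : Set ℂ)ᶜ, L.derivWeierstrassP w *
      (deriv L.derivWeierstrassP w - (6 * L.weierstrassP w ^ 2 - L.g₂ / 2)) = 0 := by
    intro w hw
    have heq : (fun x ↦ L.derivWeierstrassP x ^ 2) =ᶠ[𝓝 w]
        fun x ↦ 4 * L.weierstrassP x ^ 3 - L.g₂ * L.weierstrassP x - L.g₃ := by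
      filter_upwards [hopen.mem_nhds hw] with x hx using L.derivWeierstrassP_sq x hx
    have h₁ := (hderiv' hw).fun_pow 2
    have h₂ := ((((hderiv hw).fun_pow 3).const_mul 4).sub
      ((hderiv hw).const_mul L.g₂)).sub_const L.g₃
    have h := (h₁.congr_of_eventuallyEq heq.symm).unique h₂
    push_cast at h
    linear_combination h / 2
  rcases hP'.eq_zero_or_eq_zero_of_mul_eq_zero
    (hP'.deriv.sub ((analyticOnNhd_const.mul (hP.pow 2)).sub analyticOnNhd_const))
    hmul hconn with h | h
  · exfalso
    obtain ⟨a, ha⟩ := hopen.exists_is_const_of_deriv_eq_zero hconn hP.differentiableOn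
      (fun x hx ↦ by simpa using h x hx)
    have hev : L.weierstrassP =ᶠ[𝓝[≠] 0] fun _ ↦ a := by
      filter_upwards [self_mem_nhdsWithin,
        mem_nhdsWithin_of_mem_nhds (L.compl_lattice_sdiff_singleton_mem_nhds 0)] with x hx hx'
      exact ha x fun hxL ↦ hx' ⟨hxL, hx⟩
    have hord := L.order_weierstrassP 0 L.lattice.zero_mem
    classical
    rw [meromorphicOrderAt_congr hev, meromorphicOrderAt_const] at hord
    split_ifs at hord
    · exact absurd hord (by decide)
    · exact absurd hord (by decide)
  · exact sub_eq_zero.mp (h z hz)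

theorem PeriodPair.iteratedDeriv_weierstrassP (L : PeriodPair) {z : ℂ} (hz : z ∉ L.lattice)
    {n : ℕ} (hn : n ≠ 0) :
    iteratedDeriv n L.weierstrassP z = (n + 1).factorial * L.sumInvPow z (n + 2) := by
  simpa [L.weierstrassPExcept_of_notMem z hz, hn] using
    L.iteratedDeriv_weierstrassPExcept_self z (n := n)

theorem PeriodPair.derivWeierstrassP_half (L : PeriodPair) (l : L.lattice) :
    L.derivWeierstrassP (l / 2) = 0 := by
  rw [← CharZero.eq_neg_self_iff, ← L.derivWeierstrassP_neg,
    ← L.derivWeierstrassP_add_coe (-(l / 2)) l]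
  congr 1
  ring

theorem PeriodPair.sumInvPow_four (L : PeriodPair) {z : ℂ} (hz : z ∉ L.lattice) :
    L.sumInvPow z 4 = L.weierstrassP z ^ 2 - L.g₂ / 12 := by
  have h := L.iteratedDeriv_weierstrassP hz two_ne_zero
  rw [iteratedDeriv_succ, iteratedDeriv_one, L.deriv_weierstrassP,
    L.deriv_derivWeierstrassP hz] at h
  norm_num [Nat.factorial] at h
  linear_combination -h / 6

open Filter Topology in
theorem PeriodPair.sumInvPow_six (L : PeriodPair) {z : ℂ} (hz : z ∉ L.lattice) :
    10 * L.sumInvPow z 6 = L.derivWeierstrassP z ^ 2 +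
      L.weierstrassP z * (6 * L.weierstrassP z ^ 2 - L.g₂ / 2) := by
  have hopen : IsOpen (L.lattice : Set ℂ)ᶜ := L.isClosed_lattice.isOpen_compl
  have hderiv {w : ℂ} (hw : w ∈ (L.lattice : Set ℂ)ᶜ) :
      HasDerivAt L.weierstrassP (L.derivWeierstrassP w) w := by
    simpa using (L.analyticOnNhd_weierstrassP w hw).differentiableAt.hasDerivAt
  have hderiv' {w : ℂ} (hw : w ∈ (L.lattice : Set ℂ)ᶜ) :
      HasDerivAt L.derivWeierstrassP (6 * L.weierstrassP w ^ 2 - L.g₂ / 2) w := by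
    rw [← L.deriv_derivWeierstrassP hw]
    exact (L.analyticOnNhd_derivWeierstrassP w hw).differentiableAt.hasDerivAt
  have h₂ {w : ℂ} (hw : w ∈ (L.lattice : Set ℂ)ᶜ) :
      iteratedDeriv 2 L.weierstrassP w = 6 * L.weierstrassP w ^ 2 - L.g₂ / 2 := by
    rw [iteratedDeriv_succ, iteratedDeriv_one, L.deriv_weierstrassP, (hderiv' hw).deriv]
  have h₃ {w : ℂ} (hw : w ∈ (L.lattice : Set ℂ)ᶜ) :
      iteratedDeriv 3 L.weierstrassP w = 12 * (L.weierstrassP w * L.derivWeierstrassP w) := by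
    rw [iteratedDeriv_succ, EventuallyEq.deriv_eq
      (eventually_of_mem (hopen.mem_nhds hw) fun x hx ↦ h₂ hx),
      ((((hderiv hw).fun_pow 2).const_mul 6).sub_const (L.g₂ / 2)).deriv]
    push_cast
    ring
  have h := L.iteratedDeriv_weierstrassP hz four_ne_zero
  rw [iteratedDeriv_succ, EventuallyEq.deriv_eq
    (eventually_of_mem (hopen.mem_nhds hz) fun x hx ↦ h₃ hx),
    (((hderiv hz).fun_mul (hderiv' hz)).const_mul 12).deriv] at h
  norm_num [Nat.factorial] at h
  linear_combination -h / 12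

/-- The pair of periods `2ω`, `2ω'`. -/
def periodPair (ω ω' : ℂ) (hω : ω ≠ 0) (hτ : (ω' / ω).im ≠ 0) : PeriodPair where
  ω₁ := 2 * ω
  ω₂ := 2 * ω'
  indep := by
    rw [LinearIndependent.pair_iff]
    intro s t h
    have h' : (s : ℂ) + t * (ω' / ω) = 0 := by
      simp only [Complex.real_smul] at h
      field_simp
      linear_combination h / 2
    have ht : t = 0 := by
      have := congrArg Complex.im h'
      simpa [hτ] using this
    subst ht
    simpa using h'

section periodPair

variable {ω ω' : ℂ} (hω : ω ≠ 0) (hτ : (ω' / ω).im ≠ 0)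

theorem coe_latticeEquivProd_symm_periodPair (p : ℤ × ℤ) :
    (((periodPair ω ω' hω hτ).latticeEquivProd.symm p : (periodPair ω ω' hω hτ).lattice) : ℂ) =
      2 * (p.1 : ℂ) * ω + 2 * (p.2 : ℂ) * ω' := by
  rw [PeriodPair.latticeEquiv_symm_apply]
  simp only [periodPair]
  ring

theorem tsum_ne_zero_eq_G {n : ℕ} (hn : n ≠ 0) :
    ∑' p : {p : ℤ × ℤ // p ≠ 0}, 1 / (2 * (p.1.1 : ℂ) * ω + 2 * (p.1.2 : ℂ) * ω') ^ n =
      (periodPair ω ω' hω hτ).G n := by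
  have hsub := tsum_subtype_eq_of_support_subset (s := {p : ℤ × ℤ | p ≠ 0})
    (f := fun p : ℤ × ℤ ↦ 1 / (2 * (p.1 : ℂ) * ω + 2 * (p.2 : ℂ) * ω') ^ n)
    (by rintro p hp rfl; simp [hn] at hp)
  refine hsub.trans ?_
  rw [PeriodPair.G, ← (periodPair ω ω' hω hτ).latticeEquivProd.symm.toEquiv.tsum_eq]
  refine tsum_congr fun p ↦ ?_
  simp [coe_latticeEquivProd_symm_periodPair]

theorem g2inv_eq : g2inv ω ω' = (periodPair ω ω' hω hτ).g₂ := by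
  rw [g2inv, tsum_ne_zero_eq_G hω hτ four_ne_zero, PeriodPair.g₂]

theorem g3inv_eq : g3inv ω ω' = (periodPair ω ω' hω hτ).g₃ := by
  rw [g3inv, tsum_ne_zero_eq_G hω hτ (by norm_num), PeriodPair.g₃]

theorem wp_eq (z : ℂ) : wp ω ω' z = (periodPair ω ω' hω hτ).weierstrassP z := by
  rw [← PeriodPair.weierstrassPExcept_add _ 0, wp, PeriodPair.weierstrassPExcept, add_comm]
  congr 1
  · have hsub := tsum_subtype_eq_of_support_subset (s := {p : ℤ × ℤ | p ≠ 0})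
      (f := fun p : ℤ × ℤ ↦ if p = 0 then 0 else
        1 / (z - (2 * (p.1 : ℂ) * ω + 2 * (p.2 : ℂ) * ω')) ^ 2
          - 1 / (2 * (p.1 : ℂ) * ω + 2 * (p.2 : ℂ) * ω') ^ 2)
      (by rintro p hp rfl; simp at hp)
    rw [← (periodPair ω ω' hω hτ).latticeEquivProd.symm.toEquiv.tsum_eq]
    refine Eq.trans (tsum_congr fun p ↦ (if_neg p.2).symm) (hsub.trans (tsum_congr fun p ↦ ?_))
    have hzero : ((periodPair ω ω' hω hτ).latticeEquivProd.symm p : ℂ) = 0 ↔ p = 0 := by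
      rw [ZeroMemClass.coe_eq_zero, EmbeddingLike.map_eq_zero_iff]
    rw [coe_latticeEquivProd_symm_periodPair] at hzero
    simp only [LinearEquiv.coe_toEquiv, ZeroMemClass.coe_zero, hzero,
      coe_latticeEquivProd_symm_periodPair]
  · simp

theorem half_period_notMem_lattice : ω' ∉ (periodPair ω ω' hω hτ).lattice := by
  simpa [periodPair] using (periodPair ω ω' hω hτ).ω₂_div_two_notMem_lattice

theorem derivWeierstrassP_half_period :
    (periodPair ω ω' hω hτ).derivWeierstrassP ω' = 0 := by
  simpa [periodPair] using (periodPair ω ω' hω hτ).derivWeierstrassP_half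
    ⟨_, (periodPair ω ω' hω hτ).ω₂_mem_lattice⟩

/-- The lattice with the second period halved is the disjoint union of the original lattice and
its translate by `-ω'`. -/
theorem G_periodPair_half (hτ' : (ω' / 2 / ω).im ≠ 0) {n : ℕ} (hn : 2 < n) :
    (periodPair ω (ω' / 2) hω hτ').G n =
      (periodPair ω ω' hω hτ).G n + (periodPair ω ω' hω hτ).sumInvPow ω' n := by
  set L := periodPair ω ω' hω hτ
  set M := periodPair ω (ω' / 2) hω hτ'
  have hL : ∀ p, (L.latticeEquivProd.symm p : ℂ) = _ :=
    coe_latticeEquivProd_symm_periodPair hω hτ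
  have hM : ∀ p, (M.latticeEquivProd.symm p : ℂ) = _ :=
    coe_latticeEquivProd_symm_periodPair hω hτ'
  let f : ℤ × ℤ → ℂ := fun p ↦ ((2 * (p.1 : ℂ) * ω + (p.2 : ℂ) * ω') ^ n)⁻¹
  let e : ℤ × ℤ → ℤ × ℤ := fun p ↦ (p.1, 2 * p.2)
  let o : ℤ × ℤ → ℤ × ℤ := fun p ↦ (p.1, 2 * p.2 - 1)
  have he : Function.Injective e := fun p q h ↦ by
    simp only [e, Prod.mk.injEq] at h
    exact Prod.ext h.1 (by lia)
  have ho : Function.Injective o := fun p q h ↦ by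
    simp only [o, Prod.mk.injEq] at h
    exact Prod.ext h.1 (by lia)
  have hcompl : IsCompl (Set.range e) (Set.range o) := by
    constructor
    · rw [Set.disjoint_left]
      rintro _ ⟨p, rfl⟩ ⟨q, hq⟩
      simp only [e, o, Prod.mk.injEq] at hq
      lia
    · rw [codisjoint_iff_le_sup]
      rintro ⟨m, k⟩ -
      obtain ⟨j, hj⟩ | ⟨j, hj⟩ := Int.even_or_odd k
      · exact Or.inl ⟨(m, j), Prod.ext rfl (by simp only [e]; lia)⟩
      · exact Or.inr ⟨(m, j + 1), Prod.ext rfl (by simp only [o]; lia)⟩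
  have hsum_even : HasSum (f ∘ e) (L.G n) := by
    have h := L.latticeEquivProd.symm.toEquiv.hasSum_iff.mpr (L.hasSum_sumInvPow 0 hn)
    rw [PeriodPair.sumInvPow_zero] at h
    convert! h using 1
    funext p
    simp only [f, e, Function.comp_apply, LinearEquiv.coe_toEquiv, hL]
    push_cast
    ring
  have hsum_odd : HasSum (f ∘ o) (L.sumInvPow ω' n) := by
    have h := L.latticeEquivProd.symm.toEquiv.hasSum_iff.mpr (L.hasSum_sumInvPow ω' hn)
    convert! h using 1
    funext p
    simp only [f, o, Function.comp_apply, LinearEquiv.coe_toEquiv, hL]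
    push_cast
    ring
  have hsum : HasSum f (M.G n) := by
    have h := M.latticeEquivProd.symm.toEquiv.hasSum_iff.mpr (M.hasSum_sumInvPow 0 hn)
    rw [PeriodPair.sumInvPow_zero] at h
    convert! h using 1
    funext p
    simp only [f, Function.comp_apply, LinearEquiv.coe_toEquiv, hM]
    ring
  exact hsum.unique (HasSum.add_isCompl hcompl (he.hasSum_range_iff.mpr hsum_even)
    (ho.hasSum_range_iff.mpr hsum_odd))

end periodPair

/-- Quadratic modular transformation: halving the period 2ω′ sends the invariants
(g₂, g₃) to (60b² − 4g₂, 56b³ + 8g₃) where b = ℘(ω′). -/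
theorem stmt4 (ω ω' : ℂ) (hω : ω ≠ 0) (hτ : (ω' / ω).im ≠ 0)
    (g₂ g₃ b : ℂ) (hg₂ : g₂ = g2inv ω ω') (hg₃ : g₃ = g3inv ω ω')
    (hb : b = wp ω ω' ω') :
    g2inv ω (ω' / 2) = 60 * b ^ 2 - 4 * g₂ ∧
    g3inv ω (ω' / 2) = 56 * b ^ 3 + 8 * g₃ := by
  have hτ' : (ω' / 2 / ω).im ≠ 0 := by
    rw [div_right_comm, Complex.div_ofNat_im]
    exact div_ne_zero hτ two_ne_zero
  have hmem := half_period_notMem_lattice hω hτ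
  have h₄ := PeriodPair.sumInvPow_four _ hmem
  have h₆ := PeriodPair.sumInvPow_six _ hmem
  have hsq := PeriodPair.derivWeierstrassP_sq _ _ hmem
  rw [derivWeierstrassP_half_period] at h₆ hsq
  rw [g2inv_eq hω hτ', g3inv_eq hω hτ', PeriodPair.g₂, PeriodPair.g₃,
    G_periodPair_half hω hτ hτ' (by norm_num), G_periodPair_half hω hτ hτ' (by norm_num)]
  rw [g2inv_eq hω hτ] at hg₂
  rw [g3inv_eq hω hτ] at hg₃
  rw [wp_eq hω hτ] at hb
  rw [← hb, ← hg₂] at h₄ h₆ hsq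
  rw [← hg₃] at hsq
  rw [PeriodPair.g₂] at hg₂
  rw [PeriodPair.g₃] at hg₃
  constructor
  · linear_combination 60 * h₄ - hg₂
  · linear_combination 14 * h₆ - hg₃ - 7 * hsq
end

section
/- Fix κ ∈ (0,1) and λ = √(1−κ²). Let p_κ be the Weierstrass ℘-function with invariants g₂ = (4/27)(9−8κ²) and g₃ = (8/729)(27−36κ²+8κ⁴), with fundamental half-periods ω_κ (positive real) and ω_κ′ (positive imaginary part, −i·ω_κ′ > 0). If p_κ(2ω_κ′/3) = −1/3, then ℘(z; ω_κ, ω_κ′/3) = −3·p_λ(√3·i·z), where p_λ is the ℘-function with the same invariants formed from λ. -/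
open Complex

open Filter Topology

namespace PeriodPair

variable (L M : PeriodPair)

lemma tsum_lattice_eq_tsum_prod (f : ℂ → ℂ) :
    ∑' l : L.lattice, f l = ∑' p : ℤ × ℤ, f (p.1 * L.ω₁ + p.2 * L.ω₂) := by
  rw [← L.latticeEquivProd.symm.toEquiv.tsum_eq]
  exact tsum_congr fun p ↦ congrArg f (L.latticeEquiv_symm_apply p)

lemma summable_prod {f : ℂ → ℂ} (hf : Summable fun l : L.lattice ↦ f l) :
    Summable fun p : ℤ × ℤ ↦ f (p.1 * L.ω₁ + p.2 * L.ω₂) := by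
  rw [← L.latticeEquivProd.symm.toEquiv.summable_iff] at hf
  exact hf.congr fun p ↦ congrArg f (L.latticeEquiv_symm_apply p)

lemma tsum_lattice_eq_add_tsum_ne_zero {f : ℂ → ℂ} (hf : Summable fun l : L.lattice ↦ f l) :
    ∑' l : L.lattice, f l =
      f 0 + ∑' p : {p : ℤ × ℤ // p ≠ 0}, f (p.1.1 * L.ω₁ + p.1.2 * L.ω₂) := by
  rw [tsum_lattice_eq_tsum_prod,
    ← (L.summable_prod hf).tsum_subtype_add_tsum_subtype_compl {(0 : ℤ × ℤ)}]
  congr 1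
  simp

/-- The period pair whose periods are `2ω` and `2ω'`, for `ω > 0` and `ω'` on the positive
imaginary axis. -/
@[simps]
def ofHalfPeriods (ω ω' : ℂ) (hω : ω.im = 0) (hω0 : 0 < ω.re) (hω' : ω'.re = 0)
    (hω'0 : 0 < ω'.im) : PeriodPair where
  ω₁ := 2 * ω
  ω₂ := 2 * ω'
  indep := by
    refine LinearIndependent.pair_iff.mpr fun s t h ↦ ?_
    have hre := congrArg Complex.re h
    have him := congrArg Complex.im h
    simp [hω, hω', hω0.ne', hω'0.ne'] at hre him
    exact ⟨hre, him⟩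

/-- The period pair obtained by multiplying both periods by a nonzero complex number. -/
@[simps]
def scale (a : ℂ) (ha : a ≠ 0) : PeriodPair where
  ω₁ := a * L.ω₁
  ω₂ := a * L.ω₂
  indep := by
    refine LinearIndependent.pair_iff.mpr fun s t h ↦ LinearIndependent.pair_iff.mp L.indep s t ?_
    refine (mul_eq_zero.mp (?_ : a * _ = 0)).resolve_left ha
    rw [← h]
    simp only [Complex.real_smul]
    ring

lemma tsum_scale (a : ℂ) (ha : a ≠ 0) (f : ℂ → ℂ) :
    ∑' l : (L.scale a ha).lattice, f l = ∑' l : L.lattice, f (a * l) := by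
  rw [tsum_lattice_eq_tsum_prod, tsum_lattice_eq_tsum_prod L fun l ↦ f (a * l)]
  refine tsum_congr fun p ↦ congrArg f ?_
  simp only [scale_ω₁, scale_ω₂]
  ring

lemma G_scale (a : ℂ) (ha : a ≠ 0) (n : ℕ) : (L.scale a ha).G n = (a ^ n)⁻¹ * L.G n := by
  rw [G, G, L.tsum_scale a ha fun l ↦ (l ^ n)⁻¹, ← tsum_mul_left]
  simp only [mul_pow, mul_inv]

lemma weierstrassP_scale (a : ℂ) (ha : a ≠ 0) (z : ℂ) :
    ℘[L.scale a ha] z = (a ^ 2)⁻¹ * ℘[L] (a⁻¹ * z) := by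
  rw [weierstrassP, weierstrassP, L.tsum_scale a ha fun l ↦ 1 / (z - l) ^ 2 - 1 / l ^ 2,
    ← tsum_mul_left]
  refine tsum_congr fun l ↦ ?_
  rw [show z - a * l = a * (a⁻¹ * z - l) by field_simp]
  simp only [mul_pow, one_div, mul_inv]
  ring

lemma sumInvPow_neg {n : ℕ} (hn : Even n) (x : ℂ) : L.sumInvPow (-x) n = L.sumInvPow x n := by
  rw [sumInvPow, sumInvPow, ← (Equiv.neg L.lattice).tsum_eq]
  refine tsum_congr fun l ↦ ?_
  rw [← hn.neg_pow]
  simp [neg_add_eq_sub, sub_eq_add_neg]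

lemma sumInvPow_sub_coe (x : ℂ) (l : L.lattice) (n : ℕ) :
    L.sumInvPow (x - l) n = L.sumInvPow x n := by
  rw [sumInvPow, sumInvPow, ← (Equiv.subRight l).tsum_eq]
  simp

/-- Trisecting the second period: the Eisenstein series of the finer lattice. -/
lemma G_eq_of_trisect (h₁ : M.ω₁ = L.ω₁) (h₂ : 3 * M.ω₂ = L.ω₂) {n : ℕ} (hn : 2 < n)
    (hn' : Even n) : M.G n = L.G n + 2 * L.sumInvPow M.ω₂ n := by
  let e : Fin 3 × (ℤ × ℤ) ≃ ℤ × ℤ :=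
    (Equiv.prodComm _ _).trans <| (Equiv.prodAssoc _ _ _).trans <|
      Equiv.prodCongr (.refl ℤ) (Int.divModEquiv 3).symm
  have hs := M.summable_prod (f := fun l ↦ (l ^ n)⁻¹) <| by
    simpa using (M.hasSum_sumInvPow 0 hn).summable
  have key (r : Fin 3) : ∑' p : ℤ × ℤ,
      ((((e (r, p)).1 : ℂ) * M.ω₁ + (e (r, p)).2 * M.ω₂) ^ n)⁻¹ =
        L.sumInvPow (-(r : ℕ) * M.ω₂) n := by
    rw [sumInvPow, L.tsum_lattice_eq_tsum_prod fun l ↦ ((l - (-(r : ℕ) * M.ω₂)) ^ n)⁻¹]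
    refine tsum_congr fun p ↦ ?_
    simp [e, ← h₁, ← h₂]
    ring
  have h3 : L.sumInvPow (2 * M.ω₂) n = L.sumInvPow M.ω₂ n := by
    rw [← L.sumInvPow_neg hn']
    rw [← L.sumInvPow_sub_coe M.ω₂ ⟨L.ω₂, L.ω₂_mem_lattice⟩]
    congr 1
    linear_combination -h₂
  rw [G, M.tsum_lattice_eq_tsum_prod fun l ↦ (l ^ n)⁻¹, ← e.tsum_eq]
  refine (e.summable_iff.mpr hs).tsum_prod.trans ?_
  rw [tsum_fintype]
  simp only [Function.comp_apply, key, Fin.sum_univ_three]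
  simp [L.sumInvPow_neg hn', h3]
  ring

lemma countable_lattice : (L.lattice : Set ℂ).Countable :=
  (Equiv.countable_iff L.latticeEquivProd.toEquiv).mpr inferInstance

lemma isPreconnected_compl_lattice : IsPreconnected (L.latticeᶜ : Set ℂ) :=
  (L.countable_lattice.isConnected_compl_of_one_lt_rank (by simp)).2

lemma eventually_notMem_lattice (x : ℂ) : ∀ᶠ z in 𝓝[≠] x, z ∉ L.lattice := by
  filter_upwards [self_mem_nhdsWithin,
    mem_nhdsWithin_of_mem_nhds (L.compl_lattice_sdiff_singleton_mem_nhds x)] with w hw hw'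
  simp_all

lemma weierstrassP_eq_weierstrassPExcept_zero (z : ℂ) : ℘[L] z = L.weierstrassPExcept 0 z + 1 / z ^ 2 := by
  simpa using (L.weierstrassPExcept_add 0 z).symm

lemma derivWeierstrassP_eq_derivWeierstrassPExcept_zero (z : ℂ) :
    ℘'[L] z = L.derivWeierstrassPExcept 0 z - 2 / z ^ 3 := by
  simpa using (L.derivWeierstrassPExcept_sub 0 z).symm

lemma not_eqOn_derivWeierstrassP_zero : ¬ ∀ z ∉ L.lattice, ℘'[L] z = 0 := by
  intro h
  have hc : ContinuousAt (fun z ↦ L.derivWeierstrassPExcept 0 z * z ^ 3) 0 := by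
    have := (L.analyticAt_derivWeierstrassPExcept 0).continuousAt
    fun_prop
  have h2 : ∀ᶠ z in 𝓝[≠] (0 : ℂ), (2 : ℂ) = L.derivWeierstrassPExcept 0 z * z ^ 3 := by
    filter_upwards [L.eventually_notMem_lattice 0, self_mem_nhdsWithin] with z hz (hz0 : z ≠ 0)
    have := L.derivWeierstrassP_eq_derivWeierstrassPExcept_zero z
    rw [h z hz] at this
    field_simp at this
    linear_combination this
  have := tendsto_nhds_unique_of_eventuallyEq tendsto_const_nhds
    (hc.tendsto.mono_left nhdsWithin_le_nhds) h2
  simp at this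

lemma hasDerivAt_weierstrassP {z : ℂ} (hz : z ∉ L.lattice) : HasDerivAt ℘[L] (℘'[L] z) z := by
  rw [← L.deriv_weierstrassP]
  exact (L.analyticOnNhd_weierstrassP z hz).differentiableAt.hasDerivAt

/-- The derivative of `℘'[L]` is `6 ℘² - g₂ / 2`. -/
lemma hasDerivAt_derivWeierstrassP {z : ℂ} (hz : z ∉ L.lattice) :
    HasDerivAt ℘'[L] (6 * ℘[L] z ^ 2 - L.g₂ / 2) z := by
  have hd {w : ℂ} (hw : w ∉ L.lattice) : HasDerivAt ℘'[L] (deriv ℘'[L] w) w :=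
    (L.analyticOnNhd_derivWeierstrassP w hw).differentiableAt.hasDerivAt
  have hP := L.analyticOnNhd_weierstrassP
  have hP' := L.analyticOnNhd_derivWeierstrassP
  have hA : AnalyticOnNhd ℂ (fun w ↦ deriv ℘'[L] w - (6 * ℘[L] w ^ 2 - L.g₂ / 2))
      L.latticeᶜ := fun w hw ↦ by
    have := hP w hw
    have := (hP' w hw).deriv
    fun_prop
  have hmul : ∀ w ∈ (L.latticeᶜ : Set ℂ),
      ℘'[L] w * (deriv ℘'[L] w - (6 * ℘[L] w ^ 2 - L.g₂ / 2)) = 0 := fun w hw ↦ by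
    have h1 := (hd hw).pow 2
    have h2 := ((((L.hasDerivAt_weierstrassP hw).pow 3).const_mul 4).sub
      ((L.hasDerivAt_weierstrassP hw).const_mul L.g₂)).sub_const L.g₃
    have h3 := h1.unique (h2.congr_of_eventuallyEq <| by
      filter_upwards [L.isClosed_lattice.isOpen_compl.mem_nhds hw] with y hy
      simpa using L.derivWeierstrassP_sq y hy)
    norm_num at h3
    linear_combination h3 / 2
  rcases hP'.eq_zero_or_eq_zero_of_mul_eq_zero hA hmul L.isPreconnected_compl_lattice with h | h
  · exact absurd h L.not_eqOn_derivWeierstrassP_zero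
  · rw [← sub_eq_zero.mp (h z hz)]
    exact hd hz

lemma sumInvPow_four_s9 {c : ℂ} (hc : c ∉ L.lattice) :
    6 * L.sumInvPow c 4 = 6 * ℘[L] c ^ 2 - L.g₂ / 2 := by
  rw [← L.deriv_derivWeierstrassPExcept_self, L.derivWeierstrassPExcept_of_notMem c hc,
    (L.hasDerivAt_derivWeierstrassP hc).deriv]

lemma sumInvPow_six_s9 {c : ℂ} (hc : c ∉ L.lattice) :
    120 * L.sumInvPow c 6 = 120 * ℘[L] c ^ 3 - 18 * L.g₂ * ℘[L] c - 12 * L.g₃ := by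
  have hU {z : ℂ} (hz : z ∉ L.lattice) : ∀ᶠ w in 𝓝 z, w ∉ L.lattice :=
    L.isClosed_lattice.isOpen_compl.mem_nhds hz
  have h2 {z : ℂ} (hz : z ∉ L.lattice) : deriv ℘'[L] z = 6 * ℘[L] z ^ 2 - L.g₂ / 2 :=
    (L.hasDerivAt_derivWeierstrassP hz).deriv
  have h3 {z : ℂ} (hz : z ∉ L.lattice) : deriv (deriv ℘'[L]) z = 12 * ℘[L] z * ℘'[L] z := by
    rw [EventuallyEq.deriv_eq ((hU hz).mono fun w hw ↦ h2 hw),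
      ((((L.hasDerivAt_weierstrassP hz).fun_pow 2).const_mul 6).sub_const (L.g₂ / 2)).deriv]
    norm_num
    ring
  have h4 : deriv (deriv (deriv ℘'[L])) c =
      12 * ℘'[L] c ^ 2 + 12 * ℘[L] c * (6 * ℘[L] c ^ 2 - L.g₂ / 2) := by
    rw [EventuallyEq.deriv_eq ((hU hc).mono fun w hw ↦ h3 hw),
      (((L.hasDerivAt_weierstrassP hc).const_mul 12).fun_mul
        (L.hasDerivAt_derivWeierstrassP hc)).deriv]
    ring
  have h := L.iteratedDeriv_weierstrassPExcept_self c (n := 4)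
  rw [L.weierstrassPExcept_of_notMem c hc] at h
  simp only [iteratedDeriv_succ, iteratedDeriv_zero, L.deriv_weierstrassP, h4,
    L.derivWeierstrassP_sq c hc] at h
  norm_num [Nat.factorial] at h
  linear_combination -h

lemma notMem_lattice_of_three_mul {c : ℂ} (h : 3 * c = L.ω₂) : c ∉ L.lattice := by
  obtain rfl : c = L.ω₂ / 3 := by linear_combination h / 3
  simpa [inv_mul_eq_div] using
    (L.mul_ω₁_add_mul_ω₂_mem_lattice (α := 0) (β := 1 / 3)).not.mpr (by norm_num)

/-- The cubic modular transformation of the invariant `g₂`. -/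
lemma g₂_eq_of_trisect (h₁ : M.ω₁ = L.ω₁) (h₂ : 3 * M.ω₂ = L.ω₂) :
    M.g₂ = 120 * ℘[L] M.ω₂ ^ 2 - 9 * L.g₂ := by
  have h := L.sumInvPow_four_s9 (L.notMem_lattice_of_three_mul h₂)
  have hG := L.G_eq_of_trisect M h₁ h₂ (n := 4) (by norm_num) (by decide)
  simp only [g₂] at h ⊢
  linear_combination 60 * hG + 20 * h

/-- The cubic modular transformation of the invariant `g₃`. -/
lemma g₃_eq_of_trisect (h₁ : M.ω₁ = L.ω₁) (h₂ : 3 * M.ω₂ = L.ω₂) :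
    M.g₃ = 280 * ℘[L] M.ω₂ ^ 3 - 42 * ℘[L] M.ω₂ * L.g₂ - 27 * L.g₃ := by
  have h := L.sumInvPow_six_s9 (L.notMem_lattice_of_three_mul h₂)
  have hG := L.G_eq_of_trisect M h₁ h₂ (n := 6) (by norm_num) (by decide)
  simp only [g₃] at h ⊢
  linear_combination 140 * hG + 7 / 3 * h

lemma eventually_weierstrassPExcept_zero_eq (h₂ : L.g₂ = M.g₂) (h₃ : L.g₃ = M.g₃) :
    ∀ᶠ z in 𝓝 0, L.weierstrassPExcept 0 z = M.weierstrassPExcept 0 z := by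
  have hL := L.analyticAt_weierstrassPExcept 0
  have hM := M.analyticAt_weierstrassPExcept 0
  by_contra hne
  obtain ⟨n, v, hv, hv0, hu⟩ := ((hL.sub hM).exists_eventuallyEq_pow_smul_nonzero_iff).mpr <| by
    simpa [sub_eq_zero] using hne
  simp only [sub_zero, smul_eq_mul, Pi.sub_apply] at hu
  have key : ∀ᶠ z in 𝓝[≠] (0 : ℂ),
      (n * v z + z * deriv v z) * ((L.derivWeierstrassPExcept 0 z + M.derivWeierstrassPExcept 0 z) * z ^ 3 - 4) =
      v z * (4 * ((L.weierstrassPExcept 0 z * z ^ 2 + 1) ^ 2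
        + (L.weierstrassPExcept 0 z * z ^ 2 + 1) * (M.weierstrassPExcept 0 z * z ^ 2 + 1)
        + (M.weierstrassPExcept 0 z * z ^ 2 + 1) ^ 2) - L.g₂ * z ^ 4) := by
    filter_upwards [self_mem_nhdsWithin, L.eventually_notMem_lattice 0,
      M.eventually_notMem_lattice 0, nhdsWithin_le_nhds hu.eventually_nhds,
      nhdsWithin_le_nhds hv.eventually_analyticAt] with z (hz : z ≠ 0) hzL hzM huz hvz
    have dL := L.hasDerivAt_weierstrassP hzL
    have dM := M.hasDerivAt_weierstrassP hzM
    have d1 := (dL.sub dM).congr_of_eventuallyEq (f₁ := fun w ↦ w ^ n * v w) <| by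
      filter_upwards [huz] with w hw
      rw [← hw, Pi.sub_apply, L.weierstrassP_eq_weierstrassPExcept_zero,
        M.weierstrassP_eq_weierstrassPExcept_zero]
      ring
    have d2 := d1.unique (((hasDerivAt_id z).fun_pow n).fun_mul hvz.differentiableAt.hasDerivAt)
    have hzn : z * (n * z ^ (n - 1)) = n * z ^ n := by
      rcases n with _ | n
      · simp
      · simp [pow_succ]; ring
    have e1 : z * (℘'[L] z - ℘'[M] z) = z ^ n * (n * v z + z * deriv v z) := by
      simp only [id] at d2
      linear_combination z * d2 + v z * hzn
    have e0 : ℘[L] z - ℘[M] z = z ^ n * v z := by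
      rw [← huz.self_of_nhds, L.weierstrassP_eq_weierstrassPExcept_zero,
        M.weierstrassP_eq_weierstrassPExcept_zero]
      ring
    have rL := L.derivWeierstrassP_sq z hzL
    have rM := M.derivWeierstrassP_sq z hzM
    rw [← h₂, ← h₃] at rM
    have p1 : L.weierstrassPExcept 0 z * z ^ 2 + 1 = ℘[L] z * z ^ 2 := by
      rw [L.weierstrassP_eq_weierstrassPExcept_zero]; field_simp
    have p2 : M.weierstrassPExcept 0 z * z ^ 2 + 1 = ℘[M] z * z ^ 2 := by
      rw [M.weierstrassP_eq_weierstrassPExcept_zero]; field_simp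
    have p3 : (L.derivWeierstrassPExcept 0 z + M.derivWeierstrassPExcept 0 z) * z ^ 3 - 4 = (℘'[L] z + ℘'[M] z) * z ^ 3 := by
      rw [L.derivWeierstrassP_eq_derivWeierstrassPExcept_zero,
        M.derivWeierstrassP_eq_derivWeierstrassPExcept_zero]
      field_simp
      ring
    rw [p1, p2, p3]
    refine mul_left_cancel₀ (pow_ne_zero n hz) ?_
    linear_combination (-(℘'[L] z + ℘'[M] z) * z ^ 3) * e1 + z ^ 4 * (rL - rM)
      + (4 * (℘[L] z ^ 2 + ℘[L] z * ℘[M] z + ℘[M] z ^ 2) - L.g₂) * z ^ 4 * e0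
  have cL := hL.continuousAt
  have cM := hM.continuousAt
  have cL' := (L.analyticAt_derivWeierstrassPExcept 0).continuousAt
  have cM' := (M.analyticAt_derivWeierstrassPExcept 0).continuousAt
  have cv := hv.continuousAt
  have cv' := hv.deriv.continuousAt
  have h0 := tendsto_nhds_unique_of_eventuallyEq
    ((ContinuousAt.tendsto (by fun_prop)).mono_left nhdsWithin_le_nhds)
    ((ContinuousAt.tendsto (by fun_prop)).mono_left nhdsWithin_le_nhds) key
  have h1 : v 0 * (n + 3 : ℕ) = 0 := by
    push_cast
    simp at h0
    linear_combination -h0 / 4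
  simp [hv0] at h1
  norm_cast at h1

/-- The Weierstrass `℘` function is determined by its invariants. -/
lemma weierstrassP_eq_of_invariants_eq (h₂ : L.g₂ = M.g₂) (h₃ : L.g₃ = M.g₃) : ℘[L] = ℘[M] := by
  have hconn : IsPreconnected ((L.lattice ∪ M.lattice : Set ℂ)ᶜ) :=
    ((L.countable_lattice.union M.countable_lattice).isConnected_compl_of_one_lt_rank
      (by simp)).2
  have hnear : ∀ᶠ z in 𝓝 0, ℘[L] z = ℘[M] z := by
    filter_upwards [L.eventually_weierstrassPExcept_zero_eq M h₂ h₃] with z hz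
    rw [L.weierstrassP_eq_weierstrassPExcept_zero, M.weierstrassP_eq_weierstrassPExcept_zero, hz]
  have hev (x : ℂ) : ∀ᶠ z in 𝓝[≠] x, z ∈ (L.lattice ∪ M.lattice : Set ℂ)ᶜ := by
    filter_upwards [L.eventually_notMem_lattice x, M.eventually_notMem_lattice x] with z h h'
    simp [h, h']
  obtain ⟨z₀, hz₀, hz₀'⟩ :=
    ((hev 0).and (nhdsWithin_le_nhds hnear.eventually_nhds)).exists
  have heq : Set.EqOn ℘[L] ℘[M] ((L.lattice ∪ M.lattice : Set ℂ)ᶜ) :=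
    (L.analyticOnNhd_weierstrassP.mono
      (Set.compl_subset_compl.mpr Set.subset_union_left)).eqOn_of_preconnected_of_eventuallyEq
      (M.analyticOnNhd_weierstrassP.mono (Set.compl_subset_compl.mpr Set.subset_union_right))
      hconn hz₀ hz₀'
  have hne (x : ℂ) : ℘[L] =ᶠ[𝓝[≠] x] ℘[M] := (hev x).mono fun z hz ↦ heq hz
  have hsub (A B : PeriodPair) (h : ∀ x, ℘[A] =ᶠ[𝓝[≠] x] ℘[B]) (x : ℂ) (hx : x ∈ A.lattice) :
      x ∈ B.lattice := by
    by_contra hxB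
    have := (B.analyticOnNhd_weierstrassP x hxB).meromorphicOrderAt_nonneg
    rw [← meromorphicOrderAt_congr (h x), A.order_weierstrassP x hx] at this
    exact absurd this (by decide)
  ext z
  by_cases hz : z ∈ L.lattice
  · exact (L.weierstrassP_coe ⟨z, hz⟩).trans (M.weierstrassP_coe ⟨z, hsub L M hne z hz⟩).symm
  · exact heq (by simpa [hz] using fun h ↦ hz (hsub M L (fun x ↦ (hne x).symm) z h))

end PeriodPair

section HalfPeriods

open PeriodPair

variable {L : PeriodPair} {ω ω' : ℂ}

lemma wp_eq_weierstrassP (h₁ : L.ω₁ = 2 * ω) (h₂ : L.ω₂ = 2 * ω') (z : ℂ) :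
    wp ω ω' z = ℘[L] z := by
  rw [weierstrassP, L.tsum_lattice_eq_add_tsum_ne_zero
    (f := fun l ↦ 1 / (z - l) ^ 2 - 1 / l ^ 2) (L.hasSum_weierstrassP z).summable, wp]
  simp [h₁, h₂, mul_assoc, mul_left_comm]

lemma tsum_one_div_pow_eq_G (h₁ : L.ω₁ = 2 * ω) (h₂ : L.ω₂ = 2 * ω') {n : ℕ} (hn : 2 < n) :
    ∑' p : {p : ℤ × ℤ // p ≠ 0}, 1 / (2 * (p.1.1 : ℂ) * ω + 2 * (p.1.2 : ℂ) * ω') ^ n =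
      L.G n := by
  rw [G, L.tsum_lattice_eq_add_tsum_ne_zero (f := fun l ↦ (l ^ n)⁻¹) <| by
    simpa using (L.hasSum_sumInvPow 0 hn).summable]
  simp [h₁, h₂, mul_assoc, mul_left_comm, show n ≠ 0 by lia]

lemma g2inv_eq_g₂ (h₁ : L.ω₁ = 2 * ω) (h₂ : L.ω₂ = 2 * ω') : g2inv ω ω' = L.g₂ := by
  rw [g2inv, g₂, tsum_one_div_pow_eq_G h₁ h₂ (by norm_num)]

lemma g3inv_eq_g₃ (h₁ : L.ω₁ = 2 * ω) (h₂ : L.ω₂ = 2 * ω') : g3inv ω ω' = L.g₃ := by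
  rw [g3inv, g₃, tsum_one_div_pow_eq_G h₁ h₂ (by norm_num)]

end HalfPeriods

/-- Signature three: given the invariants of p_κ and p_λ (λ the complementary modulus),
the positivity normalisation of the half-periods, and p_κ(2ω_κ′/3) = −1/3, the cubic
modular transformation gives ℘(z; ω_κ, ω_κ′/3) = −3·p_λ(√3·i·z). -/
theorem stmt9 (κ lam : ℝ) (hκ : κ ∈ Set.Ioo (0:ℝ) 1) (hlam : lam = Real.sqrt (1 - κ^2))
    (ωκ ωκ' ωl ωl' : ℂ)
    (hωκ : ωκ.im = 0) (hωκpos : 0 < ωκ.re) (hωκ' : ωκ'.re = 0) (hωκ'pos : 0 < ωκ'.im)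
    (hωl : ωl.im = 0) (hωlpos : 0 < ωl.re) (hωl' : ωl'.re = 0) (hωl'pos : 0 < ωl'.im)
    (hg₂κ : g2inv ωκ ωκ' = 4/27 * (9 - 8 * (κ:ℂ)^2))
    (hg₃κ : g3inv ωκ ωκ' = 8/729 * (27 - 36 * (κ:ℂ)^2 + 8 * (κ:ℂ)^4))
    (hg₂l : g2inv ωl ωl' = 4/27 * (9 - 8 * (lam:ℂ)^2))
    (hg₃l : g3inv ωl ωl' = 8/729 * (27 - 36 * (lam:ℂ)^2 + 8 * (lam:ℂ)^4))
    (hb : wp ωκ ωκ' (2 * ωκ' / 3) = -1/3) :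
    ∀ z : ℂ, wp ωκ (ωκ' / 3) z = -3 * wp ωl ωl' ((Real.sqrt 3 : ℂ) * Complex.I * z) := by
  intro z
  let L := PeriodPair.ofHalfPeriods ωκ ωκ' hωκ hωκpos hωκ' hωκ'pos
  let M := PeriodPair.ofHalfPeriods ωκ (ωκ' / 3) hωκ hωκpos (by simp [hωκ'])
    (by simpa using hωκ'pos)
  let N := PeriodPair.ofHalfPeriods ωl ωl' hωl hωlpos hωl' hωl'pos
  have hM : M.ω₂ = 2 * ωκ' / 3 := by
    simp only [M, PeriodPair.ofHalfPeriods_ω₂]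
    ring
  have h3 : 3 * M.ω₂ = L.ω₂ := by
    rw [hM]
    simp only [L, PeriodPair.ofHalfPeriods_ω₂]
    ring
  have hsq : ((Real.sqrt 3 : ℂ) * I) ^ 2 = -3 := by
    rw [mul_pow, I_sq, ← ofReal_pow, Real.sq_sqrt (by norm_num)]
    norm_num
  have ha : ((Real.sqrt 3 : ℂ) * I)⁻¹ ≠ 0 := by simp
  have hlam2 : (lam : ℂ) ^ 2 = 1 - (κ : ℂ) ^ 2 := by
    rw [hlam, ← ofReal_pow, Real.sq_sqrt (by nlinarith [hκ.1, hκ.2])]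
    push_cast
    rfl
  have hlam4 : (lam : ℂ) ^ 4 = (1 - (κ : ℂ) ^ 2) ^ 2 := by
    rw [← hlam2]
    ring
  rw [g2inv_eq_g₂ (L := L) rfl rfl] at hg₂κ
  rw [g3inv_eq_g₃ (L := L) rfl rfl] at hg₃κ
  rw [g2inv_eq_g₂ (L := N) rfl rfl, hlam2] at hg₂l
  rw [g3inv_eq_g₃ (L := N) rfl rfl, hlam2, hlam4] at hg₃l
  rw [wp_eq_weierstrassP (L := L) rfl rfl, ← hM] at hb
  have h₂ : M.g₂ = (N.scale _ ha).g₂ := by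
    rw [L.g₂_eq_of_trisect M rfl h3, hb, hg₂κ, PeriodPair.g₂, PeriodPair.G_scale, inv_pow, inv_inv,
      show ((Real.sqrt 3 : ℂ) * I) ^ 4 = (((Real.sqrt 3 : ℂ) * I) ^ 2) ^ 2 by ring, hsq]
    rw [PeriodPair.g₂] at hg₂l
    linear_combination -9 * hg₂l
  have h₃ : M.g₃ = (N.scale _ ha).g₃ := by
    rw [L.g₃_eq_of_trisect M rfl h3, hb, hg₂κ, hg₃κ, PeriodPair.g₃, PeriodPair.G_scale, inv_pow,
      inv_inv, show ((Real.sqrt 3 : ℂ) * I) ^ 6 = (((Real.sqrt 3 : ℂ) * I) ^ 2) ^ 3 by ring, hsq]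
    rw [PeriodPair.g₃] at hg₃l
    linear_combination 27 * hg₃l
  rw [wp_eq_weierstrassP (L := M) rfl rfl, wp_eq_weierstrassP (L := N) rfl rfl,
    M.weierstrassP_eq_of_invariants_eq _ h₂ h₃, N.weierstrassP_scale, inv_pow, inv_inv, hsq,
    inv_inv]
end

section
/- Fix κ ∈ (0,1) and λ = √(1−κ²). Let ω_κ and ω_κ′ be the fundamental half-periods (ω_κ real positive, −i·ω_κ′ > 0) of the Weierstrass function coperiodic with Shen's signature-three function with modulus κ. Given the modular-transformation identity ℘(z; ω_κ, ω_κ′/3) = −3·p_λ(√3·i·z), one has ω_κ′ = √3·i·ω_λ; consequently ω_κ = (π/2)·F(1/3, 2/3; 1; κ²) and ω_κ′ = i·(√3·π/2)·F(1/3, 2/3; 1; 1−κ²). -/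
open Complex

/-- The Gauss hypergeometric series ₂F₁(a,b;c;x) as a real function. -/
noncomputable def hypF (a b c x : ℝ) : ℝ :=
  ∑' n : ℕ, ((ascPochhammer ℝ n).eval a * (ascPochhammer ℝ n).eval b) /
    ((ascPochhammer ℝ n).eval c * n.factorial) * x ^ n

/-- The pair of periods `2ω`, `2ω'` with `ω` real positive and `ω'` positive imaginary. -/
def rectPeriodPair (ω ω' : ℂ) (hω : ω.im = 0) (hω0 : 0 < ω.re) (hω' : ω'.re = 0)
    (hω'0 : 0 < ω'.im) : PeriodPair where
  ω₁ := 2 * ω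
  ω₂ := 2 * ω'
  indep := by
    rw [LinearIndependent.pair_iff]
    intro s t h
    have hre := congrArg Complex.re h
    have him := congrArg Complex.im h
    simp [hω, hω'] at hre him
    exact ⟨hre.resolve_right hω0.ne', him.resolve_right hω'0.ne'⟩

lemma weierstrassP_eq_wp (L : PeriodPair) {ω ω' : ℂ} (h₁ : L.ω₁ = 2 * ω) (h₂ : L.ω₂ = 2 * ω') :
    L.weierstrassP = wp ω ω' := by
  funext z
  have hs := (L.latticeEquivProd.symm.toEquiv.hasSum_iff).2 (L.hasSum_weierstrassP z)
  have key := hs.summable.tsum_eq_add_tsum_ite (0 : ℤ × ℤ)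
  rw [hs.tsum_eq] at key
  have hval : ∀ p : ℤ × ℤ, ((L.latticeEquivProd.symm p : L.lattice) : ℂ)
      = 2 * (p.1 : ℂ) * ω + 2 * (p.2 : ℂ) * ω' := by
    intro p
    rw [L.latticeEquiv_symm_apply, h₁, h₂]
    ring
  rw [key, wp]
  congr 1
  · simp
  · refine Eq.trans (tsum_congr fun p => ?_) (tsum_subtype {p : ℤ × ℤ | p ≠ 0} fun p : ℤ × ℤ =>
      (1 / (z - (2 * (p.1 : ℂ) * ω + 2 * (p.2 : ℂ) * ω')) ^ 2
        - 1 / (2 * (p.1 : ℂ) * ω + 2 * (p.2 : ℂ) * ω') ^ 2)).symm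
    by_cases hp : p = 0
    · simp [hp]
    · simp [hp, hval]

/-- The discontinuities of `wp ω ω'` are exactly the lattice points. -/
lemma not_continuousAt_wp_iff {ω ω' : ℂ} (hω : ω.im = 0) (hω0 : 0 < ω.re) (hω' : ω'.re = 0)
    (hω'0 : 0 < ω'.im) (x : ℂ) :
    ¬ ContinuousAt (wp ω ω') x ↔ ∃ m n : ℤ, x = 2 * (m : ℂ) * ω + 2 * (n : ℂ) * ω' := by
  let L := rectPeriodPair ω ω' hω hω0 hω' hω'0
  have hmem : x ∈ L.lattice ↔ ∃ m n : ℤ, x = 2 * (m : ℂ) * ω + 2 * (n : ℂ) * ω' := by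
    rw [L.mem_lattice]
    refine exists_congr fun m => exists_congr fun n => ?_
    change (m : ℂ) * (2 * ω) + (n : ℂ) * (2 * ω') = x ↔ _
    rw [eq_comm]
    ring_nf
  rw [← weierstrassP_eq_wp L rfl rfl, ← hmem]
  refine ⟨fun h => ?_, L.not_continuousAt_weierstrassP x⟩
  by_contra hx
  exact h (L.differentiableOn_weierstrassP.differentiableAt
    (L.isClosed_lattice.isOpen_compl.mem_nhds hx)).continuousAt

lemma continuousAt_const_mul_comp_mul_iff (f : ℂ → ℂ) {c d : ℂ} (hc : c ≠ 0) (hd : d ≠ 0) (x : ℂ) :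
    ContinuousAt (fun z => c * f (d * z)) x ↔ ContinuousAt f (d * x) := by
  constructor
  · intro h
    have h' : ContinuousAt (fun z => c * f (d * z)) (d⁻¹ * (d * x)) := by
      rwa [inv_mul_cancel_left₀ hd]
    have h2 : ContinuousAt (fun y : ℂ => d⁻¹ * y) (d * x) := by fun_prop
    have h3 := (h'.comp h2).const_mul c⁻¹
    simpa [Function.comp_def, hc, hd] using h3
  · intro h
    have h2 : ContinuousAt (fun y : ℂ => d * y) x := by fun_prop
    exact (ContinuousAt.comp (f := fun y : ℂ => d * y) h h2).const_mul c

open Real in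
/-- Signature three half-periods: given the modular-transformation identity
℘(z; ω_κ, ω_κ′/3) = −3·p_λ(√3·i·z) and the hypergeometric formula for the real
half-periods, one has ω_κ′ = √3·i·ω_λ, and hence
ω_κ = (π/2)F(1/3,2/3;1;κ²) and ω_κ′ = i(√3π/2)F(1/3,2/3;1;1−κ²). -/
theorem stmt11 (κ lam : ℝ) (hκ : κ ∈ Set.Ioo (0:ℝ) 1) (hlam : lam = Real.sqrt (1 - κ^2))
    (ωκ ωκ' ωl ωl' : ℂ)
    (hωκ : ωκ.im = 0) (hωκpos : 0 < ωκ.re) (hωκ' : ωκ'.re = 0) (hωκ'pos : 0 < ωκ'.im)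
    (hωl : ωl.im = 0) (hωlpos : 0 < ωl.re) (hωl' : ωl'.re = 0) (hωl'pos : 0 < ωl'.im)
    (hrealκ : ωκ = ((π/2 * hypF (1/3) (2/3) 1 (κ^2) : ℝ) : ℂ))
    (hreall : ωl = ((π/2 * hypF (1/3) (2/3) 1 (lam^2) : ℝ) : ℂ))
    (hmod : ∀ z : ℂ, wp ωκ (ωκ' / 3) z = -3 * wp ωl ωl' ((Real.sqrt 3 : ℂ) * Complex.I * z)) :
    ωκ' = (Real.sqrt 3 : ℂ) * Complex.I * ωl ∧
    ωκ = ((π/2 * hypF (1/3) (2/3) 1 (κ^2) : ℝ) : ℂ) ∧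
    ωκ' = Complex.I * ((Real.sqrt 3 * π/2 * hypF (1/3) (2/3) 1 (1 - κ^2) : ℝ) : ℂ) := by
  have h3 : 0 < Real.sqrt 3 := Real.sqrt_pos.2 (by norm_num)
  have h33 : Real.sqrt 3 * Real.sqrt 3 = 3 := Real.mul_self_sqrt (by norm_num)
  have hd : (Real.sqrt 3 : ℂ) * Complex.I ≠ 0 :=
    mul_ne_zero (by exact_mod_cast h3.ne') Complex.I_ne_zero
  have hk're : (ωκ' / 3).re = 0 := by simp [hωκ']
  have hk'im : (ωκ' / 3).im = ωκ'.im / 3 := by simp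
  have hk'pos : 0 < (ωκ' / 3).im := by rw [hk'im]; positivity
  have hpole : ∀ z : ℂ, (∃ m n : ℤ, z = 2 * (m : ℂ) * ωκ + 2 * (n : ℂ) * (ωκ' / 3)) ↔
      ∃ m n : ℤ, (Real.sqrt 3 : ℂ) * Complex.I * z = 2 * (m : ℂ) * ωl + 2 * (n : ℂ) * ωl' := by
    intro z
    rw [← not_continuousAt_wp_iff hωκ hωκpos hk're hk'pos,
      ← not_continuousAt_wp_iff hωl hωlpos hωl' hωl'pos,
      ← continuousAt_const_mul_comp_mul_iff (wp ωl ωl') (by norm_num : (-3 : ℂ) ≠ 0) hd,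
      funext hmod]
  obtain ⟨m, n, hmn⟩ := (hpole (2 * (ωκ' / 3))).1 ⟨0, 1, by simp⟩
  obtain ⟨p, q, hpq⟩ := (hpole (2 * ωl / ((Real.sqrt 3 : ℂ) * Complex.I))).2
    ⟨1, 0, by rw [mul_div_cancel₀ _ hd]; simp⟩
  rw [div_eq_iff hd] at hpq
  have e1 := congrArg Complex.re hmn
  have e2 := congrArg Complex.re hpq
  simp [hωκ', hωl', hωκ, hωl] at e1 e2
  have hm : Real.sqrt 3 * ωκ'.im = -(3 * m) * ωl.re := by linarith
  have hq : 3 * ωl.re = -q * (Real.sqrt 3 * ωκ'.im) := by linarith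
  have hprod : ((q * m : ℤ) : ℝ) = 1 := by
    rw [hm] at hq
    have : (3 * ωl.re) * ((q * m : ℤ) : ℝ) = (3 * ωl.re) * 1 := by push_cast; linarith
    exact mul_left_cancel₀ (by positivity) this
  have hprod' : q * m = 1 := by exact_mod_cast hprod
  have hm1 : m = -1 := by
    rcases Int.eq_one_or_neg_one_of_mul_eq_one (by rw [mul_comm]; exact hprod' : m * q = 1) with h | h
    · subst h
      have := mul_pos h3 hωκ'pos
      push_cast at hm
      linarith
    · exact h
  have him : ωκ'.im = Real.sqrt 3 * ωl.re := by
    subst hm1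
    push_cast at hm
    refine mul_left_cancel₀ h3.ne' ?_
    rw [hm, ← mul_assoc, h33]
    ring
  have hmain : ωκ' = (Real.sqrt 3 : ℂ) * Complex.I * ωl := by
    apply Complex.ext
    · simp [hωκ', hωl]
    · simp [him]
  have hl2 : lam ^ 2 = 1 - κ ^ 2 := by
    rw [hlam, Real.sq_sqrt]
    nlinarith [hκ.1, hκ.2]
  refine ⟨hmain, hrealκ, ?_⟩
  rw [hmain, hreall, hl2]
  push_cast
  ring
end
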